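/- arXiv:1604.04177 — 6 statements merged into one kernel-verified Lean document; each statement's English description precedes it below -/
import Mathlib

section
/- There exists a unique real number σ* satisfying the traveling-wave speed equation χ^N − σ* = χ^S·σ*/√(4D_Sα + σ*²), and this σ* lies in the open interval (χ^N − χ^S, χ^N + χ^S). -/
theorem aux_pos (c a b : ℝ) (hc : 0 < c) (ha : 0 ≤ a) (hab : a ≤ b) :
    a * Real.sqrt (c + b ^ 2) ≤ b * Real.sqrt (c + a ^ 2) := by
  have h1 := Real.sq_sqrt (show 0 ≤ c + b ^ 2 by positivity)
  have h2 := Real.sq_sqrt (show 0 ≤ c + a ^ 2 by positivity)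
  have hb : 0 ≤ b := ha.trans hab
  apply le_of_sq_le_sq _ (by positivity)
  rw [mul_pow, mul_pow, h1, h2]
  have : a ^ 2 ≤ b ^ 2 := by gcongr
  nlinarith

theorem aux_mono (c a b : ℝ) (hc : 0 < c) (hab : a ≤ b) :
    a / Real.sqrt (c + a ^ 2) ≤ b / Real.sqrt (c + b ^ 2) := by
  have h1 : 0 < Real.sqrt (c + b ^ 2) := Real.sqrt_pos.2 (by positivity)
  have h2 : 0 < Real.sqrt (c + a ^ 2) := Real.sqrt_pos.2 (by positivity)
  rw [div_le_div_iff₀ h2 h1]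
  rcases le_total 0 a with ha | ha
  · exact aux_pos c a b hc ha hab
  rcases le_total 0 b with hb | hb
  · nlinarith [mul_nonneg hb h2.le, mul_nonneg (neg_nonneg.2 ha) h1.le]
  · have := aux_pos c (-b) (-a) hc (by linarith) (by linarith)
    simp only [neg_sq] at this
    linarith

theorem aux_abs (c a : ℝ) (hc : 0 < c) : |a / Real.sqrt (c + a ^ 2)| < 1 := by
  have h2 : 0 < Real.sqrt (c + a ^ 2) := Real.sqrt_pos.2 (by positivity)
  rw [abs_div, abs_of_pos h2, div_lt_one h2]
  apply Real.lt_sqrt_of_sq_lt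
  rw [sq_abs]; linarith

/-- There exists a unique real number `σ*` satisfying the traveling-wave
speed equation `χ^N − σ* = χ^S·σ*/√(4D_Sα + σ*²)`, and this `σ*` lies in the open
interval `(χ^N − χ^S, χ^N + χ^S)`. -/
theorem stmt2 (χN χS α DS : ℝ) (hχS : 0 < χS) (hα : 0 < α) (hDS : 0 < DS) :
    ∃ σstar : ℝ,
      (χN - σstar = χS * σstar / Real.sqrt (4 * DS * α + σstar ^ 2)) ∧
      σstar ∈ Set.Ioo (χN - χS) (χN + χS) ∧
      ∀ σ : ℝ, χN - σ = χS * σ / Real.sqrt (4 * DS * α + σ ^ 2) → σ = σstar := by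
  have hc : 0 < 4 * DS * α := by positivity
  generalize 4 * DS * α = c at hc
  simp only [mul_div_assoc]
  have hcont : Continuous fun σ : ℝ => σ + χS * (σ / Real.sqrt (c + σ ^ 2)) := by
    have : ∀ σ : ℝ, Real.sqrt (c + σ ^ 2) ≠ 0 := fun σ =>
      (Real.sqrt_pos.2 (by positivity)).ne'
    fun_prop (disch := exact this _)
  have hb : ∀ σ : ℝ, -χS < χS * (σ / Real.sqrt (c + σ ^ 2)) ∧
      χS * (σ / Real.sqrt (c + σ ^ 2)) < χS := by
    intro σ
    obtain ⟨h1, h2⟩ := abs_lt.1 (aux_abs c σ hc)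
    constructor <;> nlinarith
  have h0 : χN ∈ Set.Icc ((χN - χS) + χS * ((χN - χS) / Real.sqrt (c + (χN - χS) ^ 2)))
      ((χN + χS) + χS * ((χN + χS) / Real.sqrt (c + (χN + χS) ^ 2))) :=
    ⟨by linarith [(hb (χN - χS)).2], by linarith [(hb (χN + χS)).1]⟩
  obtain ⟨s, -, hs⟩ := intermediate_value_Icc (by linarith : χN - χS ≤ χN + χS)
    hcont.continuousOn h0
  simp only at hs
  refine ⟨s, by linarith, ⟨by linarith [(hb s).2], by linarith [(hb s).1]⟩, ?_⟩
  intro σ h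
  rcases le_total σ s with hle | hle
  · have := mul_le_mul_of_nonneg_left (aux_mono c _ _ hc hle) hχS.le
    linarith
  · have := mul_le_mul_of_nonneg_left (aux_mono c _ _ hc hle) hχS.le
    linarith
end

section
/- The traveling pulse profile ρ tends to 0 as z → +∞ and as z → −∞ if and only if χ^N − χ^S < σ < χ^N + χ^S. -/
/-- The traveling pulse profile `ρ` (with `ρ(z) = exp((χ^N + χ^S − σ)z/D)`
for `z ≤ 0` and `ρ(z) = exp((χ^N − χ^S − σ)z/D)` for `z > 0`) tends to `0` as
`z → +∞` and as `z → −∞` if and only if `χ^N − χ^S < σ < χ^N + χ^S`. -/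
theorem stmt3 (χN χS σ D : ℝ) (hD : 0 < D) (ρ : ℝ → ℝ)
    (hρ₁ : ∀ z : ℝ, z ≤ 0 → ρ z = Real.exp ((χN + χS - σ) * z / D))
    (hρ₂ : ∀ z : ℝ, 0 < z → ρ z = Real.exp ((χN - χS - σ) * z / D)) :
    (Filter.Tendsto ρ Filter.atTop (nhds 0) ∧ Filter.Tendsto ρ Filter.atBot (nhds 0)) ↔
      (χN - χS < σ ∧ σ < χN + χS) := by
  have e1 : ρ =ᶠ[Filter.atTop] fun z => Real.exp ((χN - χS - σ) * z / D) := by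
    filter_upwards [Filter.eventually_gt_atTop 0] with z hz using hρ₂ z hz
  have e2 : ρ =ᶠ[Filter.atBot] fun z => Real.exp ((χN + χS - σ) * z / D) := by
    filter_upwards [Filter.eventually_le_atBot 0] with z hz using hρ₁ z hz
  rw [Filter.tendsto_congr' e1, Filter.tendsto_congr' e2]
  constructor
  · rintro ⟨h1, h2⟩
    constructor
    · by_contra! h
      have h3 : (1 : ℝ) ≤ 0 := by
        refine ge_of_tendsto h1 ?_
        filter_upwards [Filter.eventually_gt_atTop 0] with z hz
        apply Real.one_le_exp
        exact div_nonneg (mul_nonneg (by linarith) hz.le) hD.le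
      linarith
    · by_contra! h
      have h3 : (1 : ℝ) ≤ 0 := by
        refine ge_of_tendsto h2 ?_
        filter_upwards [Filter.eventually_le_atBot 0] with z hz
        apply Real.one_le_exp
        exact div_nonneg (mul_nonneg_of_nonpos_of_nonpos (by linarith) hz) hD.le
      linarith
  · rintro ⟨h1, h2⟩
    constructor
    · exact Real.tendsto_exp_atBot.comp
        ((Filter.tendsto_id.const_mul_atTop_of_neg (by linarith)).atBot_div_const hD)
    · exact Real.tendsto_exp_atBot.comp
        ((Filter.tendsto_id.const_mul_atBot (by linarith)).atBot_div_const hD)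
end

section
/- For every z ≠ 0 the kernel K is twice differentiable at z and satisfies D_S·K''(z) + σ·K'(z) − α·K(z) = 0. -/
open Filter Topology in
theorem stmt6_aux (K : ℝ → ℝ) (c z : ℝ) (h : K =ᶠ[𝓝 z] fun x => Real.exp (c * x)) :
    DifferentiableAt ℝ K z ∧ DifferentiableAt ℝ (deriv K) z ∧
      deriv (deriv K) z = c ^ 2 * K z ∧ deriv K z = c * K z := by
  have hd : ∀ x, HasDerivAt (fun x => Real.exp (c * x)) (c * Real.exp (c * x)) x := by
    intro x
    have := ((hasDerivAt_id x).const_mul c).exp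
    simpa [mul_comm] using this
  have h1 : deriv K =ᶠ[𝓝 z] fun x => c * Real.exp (c * x) := by
    refine h.deriv.trans (Eventually.of_forall fun x => (hd x).deriv)
  have d1 := (hd z).congr_of_eventuallyEq h
  have d2 := ((hd z).const_mul c).congr_of_eventuallyEq h1
  refine ⟨d1.differentiableAt, d2.differentiableAt, ?_, ?_⟩
  · rw [d2.deriv, h.eq_of_nhds]; ring
  · rw [d1.deriv, h.eq_of_nhds]

/-- For every `z ≠ 0` the kernel
`K(z) = exp(−σz/(2D_S) − √(σ² + 4αD_S)·|z|/(2D_S))` is twice differentiable at `z`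
and satisfies `D_S·K''(z) + σ·K'(z) − α·K(z) = 0`. -/
theorem stmt6 (σ α DS : ℝ) (hα : 0 < α) (hDS : 0 < DS) (K : ℝ → ℝ)
    (hK : ∀ z : ℝ, K z =
      Real.exp (-σ * z / (2 * DS) - Real.sqrt (σ ^ 2 + 4 * α * DS) * |z| / (2 * DS))) :
    ∀ z : ℝ, z ≠ 0 →
      DifferentiableAt ℝ K z ∧ DifferentiableAt ℝ (deriv K) z ∧
      DS * deriv (deriv K) z + σ * deriv K z - α * K z = 0 := by
  intro z hz
  have hs : Real.sqrt (σ ^ 2 + 4 * α * DS) ^ 2 = σ ^ 2 + 4 * α * DS :=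
    Real.sq_sqrt (by positivity)
  set s := Real.sqrt (σ ^ 2 + 4 * α * DS) with hsdef
  have key : ∃ t : ℝ, t ^ 2 = σ ^ 2 + 4 * α * DS ∧
      K =ᶠ[nhds z] fun x => Real.exp (((-σ - t) / (2 * DS)) * x) := by
    rcases lt_or_gt_of_ne hz with h | h
    · refine ⟨-s, by rw [neg_sq, hs], ?_⟩
      filter_upwards [Iio_mem_nhds h] with x hx
      rw [hK, abs_of_neg hx]
      congr 1
      ring
    · refine ⟨s, hs, ?_⟩
      filter_upwards [Ioi_mem_nhds h] with x hx
      rw [hK, abs_of_pos hx]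
      congr 1
      ring
  obtain ⟨t, ht, he⟩ := key
  obtain ⟨a, b, e2, e1⟩ := stmt6_aux K _ z he
  refine ⟨a, b, ?_⟩
  rw [e2, e1]
  have : DS * ((-σ - t) / (2 * DS)) ^ 2 + σ * ((-σ - t) / (2 * DS)) - α = 0 := by
    field_simp
    linear_combination ht
  linear_combination K z * this
end

section
/- If χ^N − χ^S < σ < χ^N + χ^S, then h(σ) < 0, where h(σ) = (−σ − s(σ) − 2D_S·λ⁻)(−σ + s(σ) − 2D_S·λ⁺). -/
/-- If `χ^N − χ^S < σ < χ^N + χ^S`, then `h(σ) < 0`, where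
`h(σ) = (−σ − s(σ) − 2D_S·λ⁻)(−σ + s(σ) − 2D_S·λ⁺)` with `s(σ) = √(σ² + 4αD_S)`,
`λ⁻ = (χ^N + χ^S − σ)/D`, `λ⁺ = (χ^N − χ^S − σ)/D`. -/
theorem stmt11 (χN χS σ α DS D : ℝ) (hχS : 0 < χS) (hα : 0 < α) (hDS : 0 < DS) (hD : 0 < D)
    (h₁ : χN - χS < σ) (h₂ : σ < χN + χS) :
    (-σ - Real.sqrt (σ ^ 2 + 4 * α * DS) - 2 * DS * ((χN + χS - σ) / D)) *
      (-σ + Real.sqrt (σ ^ 2 + 4 * α * DS) - 2 * DS * ((χN - χS - σ) / D)) < 0 := by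
  have hs : |σ| < Real.sqrt (σ ^ 2 + 4 * α * DS) := by
    rw [← Real.sqrt_sq_eq_abs]
    apply Real.sqrt_lt_sqrt (sq_nonneg σ)
    have : 0 < 4 * α * DS := by positivity
    linarith
  have ha := abs_lt.mp hs
  have hm : 0 < 2 * DS * ((χN + χS - σ) / D) :=
    mul_pos (by linarith) (div_pos (by linarith) hD)
  have hp : 2 * DS * ((χN - χS - σ) / D) < 0 :=
    mul_neg_of_pos_of_neg (by linarith) (div_neg_of_neg_of_pos (by linarith) hD)
  exact mul_neg_of_neg_of_pos (by linarith [ha.1]) (by linarith [ha.2])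
end

section
/- Assume σ_1 < σ_2, I_1 ∩ I_2 ≠ ∅, σ_2 ∉ I_1 ∩ I_2 and χ_2^N − χ_2^S ∉ I_1 ∩ I_2. Then (σ_1, σ_2) ∩ (I_1 ∩ I_2) = (σ_1, χ_1^N + χ_1^S], i.e. the set of σ with σ_1 < σ < σ_2 and σ ∈ I_1 ∩ I_2 is exactly the set of σ with σ_1 < σ ≤ χ_1^N + χ_1^S. -/
/-- The function `g_i(σ) = (σ − χ^N) + χ^S·σ/√(σ² + 4αD_S)`. -/
noncomputable def gFun (χN χS α DS σ : ℝ) : ℝ :=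
  (σ - χN) + χS * σ / Real.sqrt (σ ^ 2 + 4 * α * DS)

theorem gFun_zero_mem (n s α D x : ℝ) (hs : 0 < s) (hα : 0 < α) (hD : 0 < D)
    (h : gFun n s α D x = 0) : n - s < x ∧ x < n + s := by
  unfold gFun at h
  have hp : 0 < α * D := mul_pos hα hD
  have hq : 0 < Real.sqrt (x ^ 2 + 4 * α * D) := Real.sqrt_pos.mpr (by nlinarith [sq_nonneg x])
  have habs : |x| < Real.sqrt (x ^ 2 + 4 * α * D) := by
    rw [← Real.sqrt_sq_eq_abs]
    exact Real.sqrt_lt_sqrt (sq_nonneg x) (by nlinarith)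
  obtain ⟨l, u⟩ := abs_lt.mp habs
  have hu : s * x / Real.sqrt (x ^ 2 + 4 * α * D) < s := by
    rw [div_lt_iff₀ hq]; exact mul_lt_mul_of_pos_left u hs
  have hl : -s < s * x / Real.sqrt (x ^ 2 + 4 * α * D) := by
    rw [lt_div_iff₀ hq]; nlinarith
  constructor <;> linarith

/-- With `I_i = [χ_i^N − χ_i^S, χ_i^N + χ_i^S]` and `σ_i` the unique zero
of `g_i`, assume `σ_1 < σ_2`, `I_1 ∩ I_2 ≠ ∅`, `σ_2 ∉ I_1 ∩ I_2` and
`χ_2^N − χ_2^S ∉ I_1 ∩ I_2`. Then `(σ_1, σ_2) ∩ (I_1 ∩ I_2) = (σ_1, χ_1^N + χ_1^S]`. -/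
theorem stmt14 (χ1N χ1S χ2N χ2S α DS : ℝ)
    (hχ1S : 0 < χ1S) (hχ2S : 0 < χ2S) (hα : 0 < α) (hDS : 0 < DS)
    (σ1 σ2 : ℝ)
    (hσ1 : gFun χ1N χ1S α DS σ1 = 0) (hσ2 : gFun χ2N χ2S α DS σ2 = 0)
    (hlt : σ1 < σ2)
    (hne : (Set.Icc (χ1N - χ1S) (χ1N + χ1S) ∩ Set.Icc (χ2N - χ2S) (χ2N + χ2S)).Nonempty)
    (hs2 : σ2 ∉ Set.Icc (χ1N - χ1S) (χ1N + χ1S) ∩ Set.Icc (χ2N - χ2S) (χ2N + χ2S))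
    (ha2 : χ2N - χ2S ∉ Set.Icc (χ1N - χ1S) (χ1N + χ1S) ∩ Set.Icc (χ2N - χ2S) (χ2N + χ2S)) :
    Set.Ioo σ1 σ2 ∩
        (Set.Icc (χ1N - χ1S) (χ1N + χ1S) ∩ Set.Icc (χ2N - χ2S) (χ2N + χ2S)) =
      Set.Ioc σ1 (χ1N + χ1S) := by
  have h1 := gFun_zero_mem χ1N χ1S α DS σ1 hχ1S hα hDS hσ1
  have h2 := gFun_zero_mem χ2N χ2S α DS σ2 hχ2S hα hDS hσ2
  obtain ⟨x, ⟨hx1, hx2⟩, hx3, hx4⟩ := hne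
  have hb : χ1N + χ1S < σ2 := by
    by_contra! h
    exact hs2 ⟨⟨by linarith, h⟩, by linarith, by linarith⟩
  have ha : χ2N - χ2S < χ1N - χ1S := by
    by_contra! h
    exact ha2 ⟨⟨h, by linarith⟩, le_refl _, by linarith⟩
  ext y
  simp only [Set.mem_inter_iff, Set.mem_Ioo, Set.mem_Icc, Set.mem_Ioc]
  constructor
  · rintro ⟨⟨p, _⟩, ⟨_, q⟩, _⟩
    exact ⟨p, q⟩
  · rintro ⟨p, q⟩
    refine ⟨⟨p, ?_⟩, ⟨?_, q⟩, ?_, ?_⟩ <;> linarith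
end

section
/- Let u : (−∞, 0] → ℝ be continuous on (−∞, 0] and twice differentiable on (−∞, 0), let D > 0, α > 0 and σ ∈ ℝ, assume α·u(x) ≤ D·u''(x) + σ·u'(x) for all x < 0, assume u(0) ≤ 0, and assume u(x) → 0 as x → −∞. Then u(x) ≤ 0 for all x ≤ 0. -/
/-- Let `u` be continuous on `(−∞, 0]` and twice differentiable on
`(−∞, 0)` (with first derivative `u'` and second derivative `u''` on `(−∞, 0)`),
let `D > 0`, `α > 0` and `σ ∈ ℝ`, assume `α·u(x) ≤ D·u''(x) + σ·u'(x)` for all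
`x < 0`, assume `u(0) ≤ 0`, and assume `u(x) → 0` as `x → −∞`.
Then `u(x) ≤ 0` for all `x ≤ 0`. -/
theorem stmt18 (u u' u'' : ℝ → ℝ) (D α σ : ℝ) (hD : 0 < D) (hα : 0 < α)
    (hcont : ContinuousOn u (Set.Iic 0))
    (hderiv1 : ∀ x : ℝ, x < 0 → HasDerivAt u (u' x) x)
    (hderiv2 : ∀ x : ℝ, x < 0 → HasDerivAt u' (u'' x) x)
    (hineq : ∀ x : ℝ, x < 0 → α * u x ≤ D * u'' x + σ * u' x)
    (hu0 : u 0 ≤ 0)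
    (hlim : Filter.Tendsto u Filter.atBot (nhds 0)) :
    ∀ x : ℝ, x ≤ 0 → u x ≤ 0 := by
  intro x0 hx0
  by_contra hpos
  push Not at hpos
  obtain ⟨a, ha⟩ := Filter.eventually_atBot.1 (hlim.eventually (gt_mem_nhds hpos))
  have hax : a < x0 := by
    by_contra h
    push Not at h
    exact lt_irrefl _ (ha x0 h)
  obtain ⟨m, hm, hmax⟩ := isCompact_Icc.exists_isMaxOn (s := Set.Icc a 0)
    ⟨x0, hax.le, hx0⟩ (hcont.mono (fun x hx => hx.2))
  have hmx : u x0 ≤ u m := hmax ⟨hax.le, hx0⟩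
  have ham : a < m := by
    by_contra h
    push Not at h
    exact absurd (ha m h) (not_lt.2 hmx)
  have hm0 : m < 0 := by
    refine lt_of_le_of_ne hm.2 ?_
    rintro rfl
    linarith
  have hloc : IsLocalMax u m := hmax.isLocalMax (Icc_mem_nhds ham hm0)
  have h1 : u' m = 0 := hloc.hasDerivAt_eq_zero (hderiv1 m hm0)
  have h2 : 0 < u'' m := by
    have h := hineq m hm0
    rw [h1] at h
    have h3 : 0 < α * u m := mul_pos hα (by linarith)
    have h4 : 0 < D * u'' m := by linarith
    exact (mul_pos_iff_of_pos_left hD).1 h4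
  have hd : deriv u =ᶠ[nhds m] u' := by
    filter_upwards [Iio_mem_nhds hm0] with x hx
    exact (hderiv1 x hx).deriv
  have hdd : deriv (deriv u) m = u'' m := by
    rw [hd.deriv_eq, (hderiv2 m hm0).deriv]
  have hmin : IsLocalMin u m := isLocalMin_of_deriv_deriv_pos (by rw [hdd]; exact h2)
    (by rw [(hderiv1 m hm0).deriv, h1]) (hderiv1 m hm0).continuousAt
  have hc : u =ᶠ[nhds m] fun _ => u m := by
    filter_upwards [hloc, hmin] with x hx hy
    exact le_antisymm hx hy
  have hz : deriv (deriv u) m = 0 := by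
    rw [hc.deriv.deriv_eq]
    simp
  linarith
end
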